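/- arXiv:2103.09740 — 2 statements merged into one kernel-verified Lean document; each statement's English description precedes it below -/
import Mathlib

section
/- Let Φ ∈ C¹(ℝ³, ℝ) with ∇Φ bounded, and suppose there exist C > 0 and δ > 0 such that |∇Φ(x) + x/|x|³| ≤ C/|x|^{2+δ} for all |x| ≥ 1. Let g : ℝ³ → [0,∞) be continuous with compact support and let V ∈ ℝ³. Then for all indices i, j ∈ {1,2,3}: lim_{s→∞} s · ∫_{ℝ³} ∫_{ℝ³} g(v) ∂ᵢΦ(y + s·(v − V)) ∂ⱼΦ(y) dy dv = ∫_{ℝ³} ∫_{ℝ³} g(v) · (ξ + (v − V))ᵢ · ξⱼ / ( |ξ + (v − V)|³ · |ξ|³ ) dξ dv, the limit integral being absolutely convergent. -/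
open MeasureTheory Filter

lemma coul_near (r : ℝ) : Integrable (fun x : EuclideanSpace ℝ (Fin 3) =>
    if ‖x‖ ≤ r then (‖x‖ ^ 2)⁻¹ else 0) volume := by
  have := (integrable_fun_norm_addHaar (E := EuclideanSpace ℝ (Fin 3)) volume
    (f := fun t : ℝ => if t ≤ r then (t ^ 2)⁻¹ else 0)).2 ?_
  · exact this
  · have h : IntegrableOn ((Set.Ioc 0 r).indicator (fun _ => (1 : ℝ))) (Set.Ioi 0) volume := by
      apply Integrable.integrableOn
      rw [integrable_indicator_iff measurableSet_Ioc]
      exact integrableOn_const (by simp)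
    refine h.congr_fun ?_ measurableSet_Ioi
    intro t ht
    have ht' : (0 : ℝ) < t := ht
    by_cases hr : t ≤ r
    · simp [Set.indicator, hr, ht', ht'.ne']
    · simp [Set.indicator, hr]

lemma coul_far (r : ℝ) (hr : 0 < r) : Integrable (fun x : EuclideanSpace ℝ (Fin 3) =>
    if ‖x‖ ≤ r then 0 else (‖x‖ ^ 4)⁻¹) volume := by
  have := (integrable_fun_norm_addHaar (E := EuclideanSpace ℝ (Fin 3)) volume
    (f := fun t : ℝ => if t ≤ r then 0 else (t ^ 4)⁻¹)).2 ?_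
  · exact this
  · have h : IntegrableOn ((Set.Ioi r).indicator (fun t => t ^ (-2 : ℝ))) (Set.Ioi 0) volume := by
      apply Integrable.integrableOn
      rw [integrable_indicator_iff measurableSet_Ioi]
      exact integrableOn_Ioi_rpow_of_lt (by norm_num) hr
    refine h.congr_fun ?_ measurableSet_Ioi
    intro t ht
    have ht' : (0 : ℝ) < t := ht
    by_cases hr : t ≤ r
    · simp [Set.indicator, hr]
    · have h2 : t ^ (-2 : ℝ) = (t ^ 2)⁻¹ := by
        rw [Real.rpow_neg ht'.le]; norm_num
      simp only [Set.indicator, Set.mem_Ioi, not_le.1 hr, hr, if_true, if_false, h2]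
      simp
      field_simp

lemma coul_shear (V : EuclideanSpace ℝ (Fin 3)) :
    MeasurePreserving (fun p : EuclideanSpace ℝ (Fin 3) × EuclideanSpace ℝ (Fin 3) =>
      (p.2 + (p.1 - V), p.2)) (volume.prod volume) (volume.prod volume) := by
  have h1 := measurePreserving_add_prod (volume : Measure (EuclideanSpace ℝ (Fin 3)))
    (volume : Measure (EuclideanSpace ℝ (Fin 3)))
  have h2 := (measurePreserving_sub_right (volume : Measure (EuclideanSpace ℝ (Fin 3))) V).prod
    (MeasurePreserving.id (volume : Measure (EuclideanSpace ℝ (Fin 3))))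
  convert h1.comp h2 using 1
  ext1 p
  simp [add_comm]

lemma coul_key (g : EuclideanSpace ℝ (Fin 3) → ℝ) (hg_cont : Continuous g)
    (V : EuclideanSpace ℝ (Fin 3)) (G R : ℝ) (hR : 0 < R) (hG : ∀ v, |g v| ≤ G)
    (hsupp : ∀ v, g v ≠ 0 → ‖v - V‖ ≤ R) :
    Integrable (fun p : EuclideanSpace ℝ (Fin 3) × EuclideanSpace ℝ (Fin 3) =>
      g p.1 * ((‖p.2 + (p.1 - V)‖ ^ 2)⁻¹ * (‖p.2‖ ^ 2)⁻¹)) (volume.prod volume) := by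
  have hG0 : 0 ≤ G := (abs_nonneg _).trans (hG 0)
  have hA : Integrable (fun p : EuclideanSpace ℝ (Fin 3) × EuclideanSpace ℝ (Fin 3) =>
      (if ‖p.2 + (p.1 - V)‖ ≤ 3 * R then (‖p.2 + (p.1 - V)‖ ^ 2)⁻¹ else 0) *
      (if ‖p.2‖ ≤ 2 * R then (‖p.2‖ ^ 2)⁻¹ else 0)) (volume.prod volume) :=
    (coul_shear V).integrable_comp_of_integrable ((coul_near (3 * R)).mul_prod (coul_near (2 * R)))
  have hB : Integrable (fun p : EuclideanSpace ℝ (Fin 3) × EuclideanSpace ℝ (Fin 3) =>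
      (Metric.closedBall V R).indicator (fun _ => (1 : ℝ)) p.1 *
      (if ‖p.2‖ ≤ 2 * R then 0 else (‖p.2‖ ^ 4)⁻¹)) (volume.prod volume) := by
    refine Integrable.mul_prod ?_ (coul_far (2 * R) (by positivity))
    rw [integrable_indicator_iff Metric.isClosed_closedBall.measurableSet]
    exact integrableOn_const (isCompact_closedBall V R).measure_lt_top.ne
  refine ((hA.const_mul G).add (hB.const_mul (4 * G))).mono' ?_ (ae_of_all _ ?_)
  · have : Measurable g := hg_cont.measurable
    exact Measurable.aestronglyMeasurable (by fun_prop)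
  · rintro ⟨v, x⟩
    simp only [Pi.add_apply]
    by_cases h0 : g v = 0
    · simp only [h0, zero_mul, norm_zero]
      have : 0 ≤ (Metric.closedBall V R).indicator (fun _ => (1 : ℝ)) v :=
        Set.indicator_nonneg (fun _ _ => zero_le_one) _
      split_ifs <;> positivity
    have hv := hsupp v h0
    have hmem : v ∈ Metric.closedBall V R := by rwa [mem_closedBall_iff_norm]
    rw [Set.indicator_of_mem hmem, Real.norm_eq_abs, abs_mul,
      abs_of_nonneg (a := (‖x + (v - V)‖ ^ 2)⁻¹ * (‖x‖ ^ 2)⁻¹) (by positivity)]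
    have hgv := hG v
    by_cases hx : ‖x‖ ≤ 2 * R
    · have : ‖x + (v - V)‖ ≤ 3 * R := by linarith [norm_add_le x (v - V)]
      simp only [hx, this, if_true, mul_zero, add_zero]
      gcongr
    · simp only [hx, if_false, mul_zero, zero_add, one_mul]
      push Not at hx
      have h1 : ‖x‖ / 2 ≤ ‖x + (v - V)‖ := by
        have := norm_sub_norm_le x (-(v - V))
        rw [sub_neg_eq_add, norm_neg] at this
        linarith
      have hx0 : 0 < ‖x‖ := by linarith
      calc |g v| * ((‖x + (v - V)‖ ^ 2)⁻¹ * (‖x‖ ^ 2)⁻¹)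
          ≤ G * (((‖x‖ / 2) ^ 2)⁻¹ * (‖x‖ ^ 2)⁻¹) := by gcongr
        _ = 4 * G * (‖x‖ ^ 4)⁻¹ := by field_simp; ring

lemma coul_lim {F : EuclideanSpace ℝ (Fin 3) → EuclideanSpace ℝ (Fin 3)} {C δ : ℝ} (hδ : 0 < δ)
    (hasym : ∀ x : EuclideanSpace ℝ (Fin 3), 1 ≤ ‖x‖ →
      ‖F x + (‖x‖ ^ 3)⁻¹ • x‖ ≤ C / ‖x‖ ^ (2 + δ))
    (x : EuclideanSpace ℝ (Fin 3)) (hx : x ≠ 0) (i : Fin 3) :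
    Tendsto (fun s : ℝ => s ^ 2 * F (s • x) i) atTop (nhds (-(x i / ‖x‖ ^ 3))) := by
  have hx0 : 0 < ‖x‖ := norm_pos_iff.2 hx
  rw [tendsto_iff_norm_sub_tendsto_zero]
  have hl : Tendsto (fun s : ℝ => C * (‖x‖ ^ (2 + δ))⁻¹ * s ^ (-δ)) atTop (nhds 0) := by
    simpa using (tendsto_rpow_neg_atTop hδ).const_mul (C * (‖x‖ ^ (2 + δ))⁻¹)
  refine squeeze_zero' (Eventually.of_forall fun _ => norm_nonneg _) ?_ hl
  filter_upwards [eventually_ge_atTop (1 / ‖x‖), eventually_gt_atTop 0] with s hs hs0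
  have hn : ‖s • x‖ = s * ‖x‖ := by rw [norm_smul, Real.norm_of_nonneg hs0.le]
  have h1 : 1 ≤ ‖s • x‖ := by
    rw [hn]; rwa [div_le_iff₀ hx0] at hs
  have h2 := hasym _ h1
  have h3 := (PiLp.norm_apply_le (F (s • x) + (‖s • x‖ ^ 3)⁻¹ • s • x) i).trans h2
  have e : s ^ 2 * F (s • x) i - -(x i / ‖x‖ ^ 3)
      = s ^ 2 * ((F (s • x) + (‖s • x‖ ^ 3)⁻¹ • s • x) i) := by
    rw [hn]
    simp only [PiLp.add_apply, PiLp.smul_apply, smul_eq_mul]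
    field_simp
    ring
  rw [e, norm_mul, Real.norm_of_nonneg (by positivity : 0 ≤ s ^ 2)]
  refine (mul_le_mul_of_nonneg_left h3 (by positivity)).trans (le_of_eq ?_)
  rw [hn, Real.mul_rpow hs0.le hx0.le, Real.rpow_add hs0, Real.rpow_neg hs0.le]
  norm_num
  have : 0 < s ^ δ := Real.rpow_pos_of_pos hs0 _
  have : 0 < ‖x‖ ^ (2 + δ) := Real.rpow_pos_of_pos hx0 _
  field_simp

lemma coul_bound {F : EuclideanSpace ℝ (Fin 3) → EuclideanSpace ℝ (Fin 3)} {C δ : ℝ} (hδ : 0 < δ)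
    (hC : 0 < C) (hbdd : ∃ M, ∀ x, ‖F x‖ ≤ M)
    (hasym : ∀ x : EuclideanSpace ℝ (Fin 3), 1 ≤ ‖x‖ →
      ‖F x + (‖x‖ ^ 3)⁻¹ • x‖ ≤ C / ‖x‖ ^ (2 + δ)) :
    ∃ A : ℝ, 0 ≤ A ∧ ∀ x, x ≠ 0 → ‖F x‖ ≤ A * (‖x‖ ^ 2)⁻¹ := by
  obtain ⟨M, hM⟩ := hbdd
  have hM0 : 0 ≤ M := (norm_nonneg _).trans (hM 0)
  refine ⟨M + (1 + C), by positivity, fun x hx => ?_⟩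
  have hx0 : 0 < ‖x‖ := norm_pos_iff.2 hx
  rcases le_total 1 ‖x‖ with h1 | h1
  · have h2 := hasym x h1
    have h3 : C / ‖x‖ ^ (2 + δ) ≤ C * (‖x‖ ^ 2)⁻¹ := by
      rw [div_eq_mul_inv]
      gcongr
      have := Real.rpow_le_rpow_of_exponent_le h1 (by linarith : (2 : ℝ) ≤ 2 + δ)
      simpa using this
    have h4 : ‖(‖x‖ ^ 3)⁻¹ • x‖ = (‖x‖ ^ 2)⁻¹ := by
      rw [norm_smul, Real.norm_of_nonneg (by positivity)]
      field_simp
    have h5 := norm_sub_le (F x + (‖x‖ ^ 3)⁻¹ • x) ((‖x‖ ^ 3)⁻¹ • x)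
    rw [add_sub_cancel_right, h4] at h5
    have : 0 ≤ M * (‖x‖ ^ 2)⁻¹ := by positivity
    linarith
  · have : 1 ≤ (‖x‖ ^ 2)⁻¹ := (one_le_inv₀ (by positivity)).2 (pow_le_one₀ hx0.le h1)
    calc ‖F x‖ ≤ M := hM x
      _ ≤ (M + (1 + C)) * 1 := by linarith
      _ ≤ _ := by gcongr

/-- Asymptotics of the force–force correlation kernel for Coulomb-like potentials:
if `∇Φ(x) ~ −x/|x|³` at infinity (with error `O(|x|^{-(2+δ)})`), `∇Φ` is bounded, and
`g ≥ 0` is continuous with compact support, then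
`s ∫∫ g(v) ∂ᵢΦ(y + s(v−V)) ∂ⱼΦ(y) dy dv →
  ∫∫ g(v) (ξ+(v−V))ᵢ ξⱼ / (|ξ+(v−V)|³ |ξ|³) dξ dv` as `s → ∞`,
the limit integral being absolutely convergent. -/
theorem coulomb_correlation_asymptotics
    (Φ : EuclideanSpace ℝ (Fin 3) → ℝ) (hΦ : ContDiff ℝ 1 Φ)
    (hbdd : ∃ M, ∀ x, ‖gradient Φ x‖ ≤ M)
    (C δ : ℝ) (hC : 0 < C) (hδ : 0 < δ)
    (hasym : ∀ x : EuclideanSpace ℝ (Fin 3), 1 ≤ ‖x‖ →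
      ‖gradient Φ x + (‖x‖ ^ 3)⁻¹ • x‖ ≤ C / ‖x‖ ^ (2 + δ))
    (g : EuclideanSpace ℝ (Fin 3) → ℝ) (hg_cont : Continuous g)
    (hg_supp : HasCompactSupport g) (hg_nonneg : ∀ x, 0 ≤ g x)
    (V : EuclideanSpace ℝ (Fin 3)) (i j : Fin 3) :
    Integrable (fun p : EuclideanSpace ℝ (Fin 3) × EuclideanSpace ℝ (Fin 3) =>
        g p.1 * ((p.2 + (p.1 - V)) i * p.2 j)
          / (‖p.2 + (p.1 - V)‖ ^ 3 * ‖p.2‖ ^ 3)) (volume.prod volume) ∧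
    Tendsto (fun s : ℝ => s * ∫ v, ∫ y,
        g v * gradient Φ (y + s • (v - V)) i * gradient Φ y j)
      atTop
      (nhds (∫ v, ∫ ξ, g v * ((ξ + (v - V)) i * ξ j)
          / (‖ξ + (v - V)‖ ^ 3 * ‖ξ‖ ^ 3))) := by
  have hFc : Continuous (gradient Φ) := by
    unfold gradient
    exact (InnerProductSpace.toDual ℝ (EuclideanSpace ℝ (Fin 3))).symm.continuous.comp
      (hΦ.continuous_fderiv (by norm_num))
  generalize gradient Φ = F at hFc hbdd hasym ⊢
  obtain ⟨A, hA0, hA⟩ := coul_bound hδ hC hbdd hasym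
  obtain ⟨G, hG⟩ := hg_cont.bounded_above_of_compact_support hg_supp
  obtain ⟨R, hR, hsupp⟩ : ∃ R, 0 < R ∧ ∀ v, g v ≠ 0 → ‖v - V‖ ≤ R := by
    obtain ⟨R, hR⟩ := hg_supp.isCompact.isBounded.subset_closedBall V
    refine ⟨max R 1, by positivity, fun v hv => ?_⟩
    have := hR (subset_tsupport g hv)
    rw [mem_closedBall_iff_norm] at this
    exact this.trans (le_max_left _ _)
  have hkey := coul_key g hg_cont V G R hR hG hsupp
  have hgm : Measurable g := hg_cont.measurable
  have hFi : ∀ k, Measurable (fun x => F x k) := fun k => by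
    have := hFc.measurable
    fun_prop
  have hcomp : ∀ (x : EuclideanSpace ℝ (Fin 3)) (k : Fin 3),
      ‖x k / ‖x‖ ^ 3‖ ≤ (‖x‖ ^ 2)⁻¹ := by
    intro x k
    rcases eq_or_ne x 0 with rfl | hx
    · simp
    have hx0 : 0 < ‖x‖ := norm_pos_iff.2 hx
    rw [norm_div, Real.norm_of_nonneg (by positivity : 0 ≤ ‖x‖ ^ 3), div_le_iff₀ (by positivity)]
    refine (PiLp.norm_apply_le x k).trans (le_of_eq ?_)
    field_simp
  have hint : Integrable (fun p : EuclideanSpace ℝ (Fin 3) × EuclideanSpace ℝ (Fin 3) =>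
        g p.1 * ((p.2 + (p.1 - V)) i * p.2 j)
          / (‖p.2 + (p.1 - V)‖ ^ 3 * ‖p.2‖ ^ 3)) (volume.prod volume) := by
    refine hkey.mono' (Measurable.aestronglyMeasurable (by fun_prop)) (ae_of_all _ fun p => ?_)
    rw [mul_div_assoc, mul_div_mul_comm, norm_mul, norm_mul, Real.norm_of_nonneg (hg_nonneg _)]
    have h1 := hcomp (p.2 + (p.1 - V)) i
    have h2 := hcomp p.2 j
    have := hg_nonneg p.1
    gcongr
  refine ⟨hint, ?_⟩
  have hne : ∀ᵐ x : EuclideanSpace ℝ (Fin 3) ∂volume, x ≠ 0 := by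
    simp [ae_iff]
  have hae : ∀ᵐ p : EuclideanSpace ℝ (Fin 3) × EuclideanSpace ℝ (Fin 3) ∂(volume.prod volume),
      p.2 ≠ 0 ∧ p.2 + (p.1 - V) ≠ 0 := by
    refine Eventually.and ?_ ?_
    · exact Measure.quasiMeasurePreserving_snd.ae hne
    · exact (Measure.quasiMeasurePreserving_fst.comp
        (coul_shear V).quasiMeasurePreserving).ae hne
  have hbd : ∀ (s : ℝ), 0 < s → ∀ x : EuclideanSpace ℝ (Fin 3), x ≠ 0 → ∀ k,
      ‖s ^ 2 * F (s • x) k‖ ≤ A * (‖x‖ ^ 2)⁻¹ := by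
    intro s hs x hx k
    rw [norm_mul, Real.norm_of_nonneg (by positivity : 0 ≤ s ^ 2)]
    have h1 := (PiLp.norm_apply_le (F (s • x)) k).trans (hA (s • x) (smul_ne_zero hs.ne' hx))
    have hx0 : 0 < ‖x‖ := norm_pos_iff.2 hx
    rw [norm_smul, Real.norm_of_nonneg hs.le] at h1
    refine (mul_le_mul_of_nonneg_left h1 (by positivity)).trans (le_of_eq ?_)
    field_simp
  let f : ℝ → EuclideanSpace ℝ (Fin 3) × EuclideanSpace ℝ (Fin 3) → ℝ := fun s p =>
    g p.1 * ((s ^ 2 * F (s • (p.2 + (p.1 - V))) i) * (s ^ 2 * F (s • p.2) j))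
  have hfm : ∀ s, AEStronglyMeasurable (f s) (volume.prod volume) := by
    intro s
    have h1 := (hFi i).comp (f := fun p : EuclideanSpace ℝ (Fin 3) × EuclideanSpace ℝ (Fin 3) =>
      s • (p.2 + (p.1 - V))) (by fun_prop)
    have h2 := (hFi j).comp (f := fun p : EuclideanSpace ℝ (Fin 3) × EuclideanSpace ℝ (Fin 3) =>
      s • p.2) (by fun_prop)
    exact ((hgm.comp measurable_fst).mul
      ((h1.const_mul (s ^ 2)).mul (h2.const_mul (s ^ 2)))).aestronglyMeasurable
  have hfb : ∀ s : ℝ, 0 < s → ∀ᵐ p ∂(volume.prod volume), ‖f s p‖ ≤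
      A ^ 2 * (g p.1 * ((‖p.2 + (p.1 - V)‖ ^ 2)⁻¹ * (‖p.2‖ ^ 2)⁻¹)) := by
    intro s hs
    filter_upwards [hae] with p hp
    have h1 := hbd s hs _ hp.2 i
    have h2 := hbd s hs _ hp.1 j
    have h0 := hg_nonneg p.1
    simp only [f]
    rw [norm_mul, norm_mul, Real.norm_of_nonneg h0]
    calc _ ≤ g p.1 * ((A * (‖p.2 + (p.1 - V)‖ ^ 2)⁻¹) * (A * (‖p.2‖ ^ 2)⁻¹)) := by gcongr
      _ = _ := by ring
  have hDCT := tendsto_integral_filter_of_dominated_convergence (μ := volume.prod volume)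
    (l := (atTop : Filter ℝ)) (F := f)
    (f := fun p : EuclideanSpace ℝ (Fin 3) × EuclideanSpace ℝ (Fin 3) =>
        g p.1 * ((p.2 + (p.1 - V)) i * p.2 j)
          / (‖p.2 + (p.1 - V)‖ ^ 3 * ‖p.2‖ ^ 3))
    _ (Eventually.of_forall hfm) ((eventually_gt_atTop 0).mono hfb) (hkey.const_mul _) (by
      filter_upwards [hae] with p hp
      have h1 := coul_lim hδ hasym _ hp.2 i
      have h2 := coul_lim hδ hasym _ hp.1 j
      have h3 := (h1.mul h2).const_mul (g p.1)
      rw [neg_mul_neg, ← mul_div_mul_comm, ← mul_div_assoc] at h3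
      exact h3)
  rw [integral_prod _ hint] at hDCT
  refine hDCT.congr' ?_
  filter_upwards [eventually_gt_atTop 0] with s hs
  have hfi : Integrable (f s) (volume.prod volume) := (hkey.const_mul _).mono' (hfm s) (hfb s hs)
  rw [integral_prod _ hfi, ← integral_const_mul]
  congr 1
  ext v
  have hcs := Measure.integral_comp_smul (volume : Measure (EuclideanSpace ℝ (Fin 3)))
    (fun y => g v * F (y + s • (v - V)) i * F y j) s
  simp only [finrank_euclideanSpace, Fintype.card_fin, smul_eq_mul] at hcs
  rw [abs_of_pos (by positivity)] at hcs
  have e : ∀ x, f s (v, x) = s ^ 4 * (g v * F (s • x + s • (v - V)) i * F (s • x) j) := by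
    intro x
    simp only [f, smul_add]
    ring
  simp only [e]
  rw [integral_const_mul, hcs]
  field_simp
end

section
/- For every b ∈ ℝ³ with b ≠ 0 and all indices i, j ∈ {1,2,3}: lim_{R→∞} ∫_{{k ∈ ℝ³ : |k| ≤ R}} (kᵢ kⱼ / |k|⁴) e^{i⟨k,b⟩} dk = (π²/|b|) ( δᵢⱼ − bᵢ bⱼ / |b|² ), where δᵢⱼ is the Kronecker delta (the integrand is locally integrable near k = 0 and the limit over balls exists). -/
open MeasureTheory RealInnerProductSpace Real Filter

lemma cff_inner_T (T y : ℝ) :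
    ∫ x in (0:ℝ)..T, rexp (-(x * y)) * Real.sin x
      = (1 - rexp (-(T * y)) * (Real.cos T + y * Real.sin T)) * (1 + y ^ 2)⁻¹ := by
  have hy : (1 + y ^ 2) ≠ 0 := by positivity
  have hd : ∀ x ∈ Set.uIcc 0 T, HasDerivAt
      (fun x => - rexp (-(x * y)) * (Real.cos x + y * Real.sin x) * (1 + y ^ 2)⁻¹)
      (rexp (-(x * y)) * Real.sin x) x := by
    intro x _
    have h1 : HasDerivAt (fun x => rexp (-(x * y))) (rexp (-(x * y)) * (-(1 * y))) x :=
      (((hasDerivAt_id x).mul_const y).neg).exp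
    have h2 := (Real.hasDerivAt_cos x).add ((Real.hasDerivAt_sin x).const_mul y)
    have h3 := ((h1.neg.mul h2).mul_const (1 + y ^ 2)⁻¹)
    refine h3.congr_deriv ?_
    field_simp
    simp
    ring
  rw [intervalIntegral.integral_eq_sub_of_hasDerivAt hd (by
    apply Continuous.intervalIntegrable; fun_prop)]
  simp
  ring

lemma cff_inner_y (x : ℝ) (hx : 0 < x) :
    ∫ y in Set.Ioi (0:ℝ), rexp (-(x * y)) * Real.sin x = Real.sinc x := by
  rw [integral_mul_const]
  have := integral_exp_mul_Ioi (a := -x) (by linarith) 0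
  simp only [neg_mul] at this
  rw [this, Real.sinc_of_ne_zero hx.ne']
  simp
  ring

lemma cff_si_eq (T : ℝ) (hT : 0 < T) :
    ∫ x in (0:ℝ)..T, Real.sinc x = ∫ y in Set.Ioi (0:ℝ),
      (1 - rexp (-(T * y)) * (Real.cos T + y * Real.sin T)) * (1 + y ^ 2)⁻¹ := by
  have hInt : Integrable (Function.uncurry fun x y : ℝ => rexp (-(x * y)) * Real.sin x)
      ((volume.restrict (Set.Ioc 0 T)).prod (volume.restrict (Set.Ioi 0))) := by
    rw [integrable_prod_iff (by
      apply Continuous.aestronglyMeasurable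
      unfold Function.uncurry
      fun_prop)]
    constructor
    · filter_upwards [ae_restrict_mem measurableSet_Ioc] with x hx
      have := integrableOn_exp_mul_Ioi (a := -x) (by linarith [hx.1]) 0
      simp only [neg_mul] at this
      simpa [Function.uncurry] using Integrable.mul_const this (Real.sin x)
    · have h0 : IntegrableOn (fun x => |Real.sinc x|) (Set.Ioc 0 T) := by
        have : Continuous fun x => |Real.sinc x| := Real.continuous_sinc.abs
        exact (this.integrableOn_Icc).mono_set Set.Ioc_subset_Icc_self
      refine h0.congr ?_
      filter_upwards [ae_restrict_mem measurableSet_Ioc] with x hx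
      simp only [Function.uncurry, norm_mul, Real.norm_eq_abs, abs_exp]
      rw [integral_mul_const]
      have := integral_exp_mul_Ioi (a := -x) (by linarith [hx.1]) 0
      simp only [neg_mul] at this
      rw [this, Real.sinc_of_ne_zero hx.1.ne', abs_div, abs_of_pos hx.1]
      simp
      ring
  have := integral_integral_swap hInt
  rw [intervalIntegral.integral_of_le hT.le]
  rw [setIntegral_congr_fun (g := fun x => ∫ y in Set.Ioi (0:ℝ), rexp (-(x * y)) * Real.sin x)
    measurableSet_Ioc (fun x hx => (cff_inner_y x hx.1).symm), this]
  refine integral_congr_ae (ae_of_all _ fun y => ?_)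
  simp only
  rw [← intervalIntegral.integral_of_le hT.le, cff_inner_T]

lemma cff_dirichlet :
    Tendsto (fun T : ℝ => ∫ x in (0:ℝ)..T, Real.sinc x) atTop (nhds (π / 2)) := by
  have key : Tendsto (fun T : ℝ => ∫ y in Set.Ioi (0:ℝ),
      (1 - rexp (-(T * y)) * (Real.cos T + y * Real.sin T)) * (1 + y ^ 2)⁻¹) atTop
      (nhds (∫ y in Set.Ioi (0:ℝ), (1 + y ^ 2)⁻¹)) := by
    have hb : ∀ T y : ℝ, 0 < y →
        |rexp (-(T * y)) * (Real.cos T + y * Real.sin T)| ≤ rexp (-(T * y)) * (1 + y) := by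
      intro T y hy
      rw [abs_mul, abs_exp]
      gcongr
      refine (abs_add_le _ _).trans ?_
      rw [abs_mul, abs_of_pos hy]
      nlinarith [Real.abs_cos_le_one T, Real.abs_sin_le_one T]
    apply tendsto_integral_filter_of_dominated_convergence (fun y => 2 * (1 + y ^ 2)⁻¹)
    · refine Eventually.of_forall fun T => ?_
      apply Measurable.aestronglyMeasurable
      fun_prop
    · filter_upwards [eventually_ge_atTop 1] with T hT
      filter_upwards [ae_restrict_mem measurableSet_Ioi] with y hy
      have hy' : 0 < y := hy
      rw [norm_mul, Real.norm_eq_abs, Real.norm_eq_abs, abs_of_pos (a := (1 + y ^ 2)⁻¹) (by positivity)]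
      gcongr
      have h1 := hb T y hy
      have h2 : rexp (-(T * y)) * (1 + y) ≤ 1 := by
        rw [Real.exp_neg, inv_mul_le_iff₀ (Real.exp_pos _)]
        have := Real.add_one_le_exp (T * y)
        nlinarith
      have h3 := abs_le.1 (h1.trans h2)
      rw [abs_le]; constructor <;> linarith
    · exact (integrable_inv_one_add_sq.const_mul 2).integrableOn
    · filter_upwards [ae_restrict_mem measurableSet_Ioi] with y hy
      have hy' : 0 < y := hy
      have h1 : Tendsto (fun T : ℝ => rexp (-(T * y)) * (1 + y)) atTop (nhds 0) := by
        have : Tendsto (fun T : ℝ => rexp (-(T * y))) atTop (nhds 0) :=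
          Real.tendsto_exp_neg_atTop_nhds_zero.comp (tendsto_id.atTop_mul_const hy')
        simpa using this.mul_const (1 + y)
      have h2 : Tendsto (fun T : ℝ => rexp (-(T * y)) * (Real.cos T + y * Real.sin T)) atTop (nhds 0) :=
        squeeze_zero_norm (fun T => hb T y hy') h1
      simpa using (h2.const_sub 1).mul_const ((1 + y ^ 2)⁻¹)
  rw [integral_Ioi_inv_one_add_sq] at key
  simp only [arctan_zero, sub_zero] at key
  refine key.congr' ?_
  filter_upwards [eventually_gt_atTop 0] with T hT
  exact (cff_si_eq T hT).symm

lemma cff_log (β R : ℝ) (hβ : 0 < β) (hR : 0 < R) :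
    ∫ x in (0:ℝ)..R, Real.cos (β * x) * (Real.log R - Real.log x)
      = β⁻¹ * ∫ x in (0:ℝ)..(β * R), Real.sinc x := by
  have hi1 : IntervalIntegrable (fun x => Real.cos (β * x) * (Real.log R - Real.log x)) volume 0 R := by
    apply IntervalIntegrable.continuousOn_mul
    · exact intervalIntegrable_const.sub intervalIntegral.intervalIntegrable_log'
    · fun_prop
  have hi2 : IntervalIntegrable (fun x => Real.sinc (β * x)) volume 0 R := by
    apply Continuous.intervalIntegrable
    exact Real.continuous_sinc.comp (by fun_prop)
  have hF : (fun x => β⁻¹ * Real.sin (β * x) * (Real.log R - Real.log x))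
      = fun x => β⁻¹ * Real.sin (β * x) * Real.log R - Real.sinc (β * x) * (x * Real.log x) := by
    funext x
    rcases eq_or_ne x 0 with rfl | hx
    · simp
    · rw [Real.sinc_of_ne_zero (by positivity)]
      field_simp
  have h := intervalIntegral.integral_eq_sub_of_hasDerivAt_of_le (a := 0) (b := R)
    (f := fun x => β⁻¹ * Real.sin (β * x) * (Real.log R - Real.log x))
    (f' := fun x => Real.cos (β * x) * (Real.log R - Real.log x) - Real.sinc (β * x)) hR.le ?_ ?_
    (hi1.sub hi2)
  · rw [intervalIntegral.integral_sub hi1 hi2] at h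
    simp only [sub_self, mul_zero, Real.sin_zero, zero_mul] at h
    rw [sub_eq_zero.1 h, intervalIntegral.integral_comp_mul_left (fun x => Real.sinc x) hβ.ne']
    simp
  · rw [hF]
    apply Continuous.continuousOn
    have := Real.continuous_mul_log
    have h2 : Continuous fun x => Real.sinc (β * x) := Real.continuous_sinc.comp (by fun_prop)
    exact (by fun_prop : Continuous fun x => β⁻¹ * Real.sin (β * x) * Real.log R).sub (h2.mul this)
  · intro x hx
    have hx0 : x ≠ 0 := hx.1.ne'
    have h1 : HasDerivAt (fun x => Real.sin (β * x)) (Real.cos (β * x) * (β * 1)) x :=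
      ((hasDerivAt_id x).const_mul β).sin
    have h2 := (h1.const_mul β⁻¹).mul ((Real.hasDerivAt_log hx0).const_sub (Real.log R))
    refine h2.congr_deriv ?_
    rw [Real.sinc_of_ne_zero (by positivity)]
    field_simp
    ring

lemma cff_par (β R : ℝ) (hβ : 0 < β) (hR : 0 < R) :
    ∫ x in (0:ℝ)..R, Real.cos (β * x) * (1 - x ^ 2 / R ^ 2)
      = -2 * Real.cos (β * R) / (β ^ 2 * R) + 2 * Real.sin (β * R) / (β ^ 3 * R ^ 2) := by
  have h := intervalIntegral.integral_eq_sub_of_hasDerivAt (a := 0) (b := R)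
    (f := fun x => β⁻¹ * Real.sin (β * x) * (1 - x ^ 2 / R ^ 2)
      - 2 * (x * Real.cos (β * x)) / (β ^ 2 * R ^ 2) + 2 * Real.sin (β * x) / (β ^ 3 * R ^ 2))
    (f' := fun x => Real.cos (β * x) * (1 - x ^ 2 / R ^ 2)) ?_ ?_
  · rw [h]; simp; field_simp; ring
  · intro x _
    have h1 : HasDerivAt (fun x => Real.sin (β * x)) (Real.cos (β * x) * (β * 1)) x :=
      ((hasDerivAt_id x).const_mul β).sin
    have h2 : HasDerivAt (fun x => Real.cos (β * x)) (-Real.sin (β * x) * (β * 1)) x :=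
      ((hasDerivAt_id x).const_mul β).cos
    have h3 := ((h1.const_mul β⁻¹).mul (((hasDerivAt_pow 2 x).div_const (R ^ 2)).const_sub 1))
    have h4 := ((((hasDerivAt_id x).mul h2).const_mul 2).div_const (β ^ 2 * R ^ 2))
    have h5 := (h1.const_mul 2).div_const (β ^ 3 * R ^ 2)
    refine ((h3.sub h4).add h5).congr_deriv ?_
    simp
    field_simp
    ring
  · apply Continuous.intervalIntegrable; fun_prop

lemma cff_even (β R : ℝ) (h : ℝ → ℝ) (he : ∀ x, h (-x) = h x)
    (hi : IntervalIntegrable h volume (-R) R) (hR : 0 < R) :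
    ∫ x in (-R)..R, ((h x : ℝ) : ℂ) * Complex.exp (Complex.I * ((β * x : ℝ) : ℂ))
      = ((2 * ∫ x in (0:ℝ)..R, Real.cos (β * x) * h x : ℝ) : ℂ) := by
  have hI : IntervalIntegrable (fun x => ((h x : ℝ) : ℂ) * Complex.exp (Complex.I * ((β * x : ℝ) : ℂ)))
      volume (-R) R := by
    apply IntervalIntegrable.mul_continuousOn
    · exact ⟨hi.1.ofReal, hi.2.ofReal⟩
    · fun_prop
  have m0 : (0:ℝ) ∈ Set.uIcc (-R) R := by
    rw [Set.uIcc_of_le (by linarith)]; constructor <;> linarith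
  have ha : IntervalIntegrable (fun x => ((h x : ℝ) : ℂ) * Complex.exp (Complex.I * ((β * x : ℝ) : ℂ)))
      volume (-R) 0 := hI.mono_set (Set.uIcc_subset_uIcc_left m0)
  have hb : IntervalIntegrable (fun x => ((h x : ℝ) : ℂ) * Complex.exp (Complex.I * ((β * x : ℝ) : ℂ)))
      volume 0 R := hI.mono_set (Set.uIcc_subset_uIcc_right m0)
  rw [← intervalIntegral.integral_add_adjacent_intervals ha hb]
  have hc := ha.comp_sub_left 0
  simp only [zero_sub, neg_neg, sub_zero] at hc
  have := intervalIntegral.integral_comp_neg (a := 0) (b := R)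
    (fun x => ((h x : ℝ) : ℂ) * Complex.exp (Complex.I * ((β * x : ℝ) : ℂ)))
  rw [neg_zero] at this
  rw [← this, ← intervalIntegral.integral_add hc.symm hb, ← intervalIntegral.integral_const_mul,
    ← intervalIntegral.integral_ofReal]
  refine intervalIntegral.integral_congr fun x _ => ?_
  simp only [he]
  push_cast
  rw [Complex.cos]
  rw [show Complex.I * ((β:ℂ) * -(x:ℂ)) = -(β * x) * Complex.I by ring,
    show Complex.I * ((β:ℂ) * (x:ℂ)) = (β * x) * Complex.I by ring]
  ring

abbrev CffE := EuclideanSpace ℝ (Fin 3)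

lemma cff_mp : ∃ e : CffE ≃ᵐ ℝ × (ℝ × ℝ), MeasurePreserving e volume volume ∧
    ∀ k, e k = (k 0, (k 1, k 2)) := by
  let e1 := (MeasurableEquiv.toLp 2 (Fin 3 → ℝ)).symm
  have h1 : MeasurePreserving e1 volume volume :=
    EuclideanSpace.volume_preserving_symm_measurableEquiv_toLp (Fin 3)
  let e2 := MeasurableEquiv.piFinSuccAbove (fun _ : Fin 3 => ℝ) 0
  have h2 : MeasurePreserving e2 volume volume :=
    volume_preserving_piFinSuccAbove (fun _ : Fin 3 => ℝ) 0
  let e3 := (MeasurableEquiv.refl ℝ).prodCongr (MeasurableEquiv.finTwoArrow (α := ℝ))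
  have h3 : MeasurePreserving e3 volume volume :=
    (MeasurePreserving.id volume).prod (volume_preserving_finTwoArrow ℝ)
  exact ⟨(e1.trans e2).trans e3, h3.comp (h2.comp h1), fun k => rfl⟩

lemma cff_polar (f : ℝ → ℂ) :
    ∫ p : ℝ × ℝ, f (p.1 ^ 2 + p.2 ^ 2) = 2 * π * ∫ r in Set.Ioi (0:ℝ), (r : ℂ) * f (r ^ 2) := by
  rw [← integral_comp_polarCoord_symm]
  have : ∀ p : ℝ × ℝ, p.1 • f ((polarCoord.symm p).1 ^ 2 + (polarCoord.symm p).2 ^ 2)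
      = ((p.1 : ℂ) * f (p.1 ^ 2)) * (1:ℂ) := by
    intro p
    simp only [polarCoord_symm_apply, Complex.real_smul, mul_one]
    congr 2
    nlinarith [Real.sin_sq_add_cos_sq p.2]
  simp_rw [this]
  rw [polarCoord_target, Measure.volume_eq_prod,
    setIntegral_prod_mul (fun r : ℝ => (r:ℂ) * f (r ^ 2)) (fun _ : ℝ => (1:ℂ))]
  simp
  rw [max_eq_left (by positivity)]
  push_cast
  ring

lemma cff_cyl (f : ℝ → ℝ → ℂ)
    (hf : Integrable (fun k : CffE => f (k 0) (k 1 ^ 2 + k 2 ^ 2))) :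
    ∫ k : CffE, f (k 0) (k 1 ^ 2 + k 2 ^ 2)
      = ∫ x : ℝ, 2 * π * ∫ r in Set.Ioi (0:ℝ), (r : ℂ) * f x (r ^ 2) := by
  obtain ⟨e, he, hk⟩ := cff_mp
  let g : ℝ × (ℝ × ℝ) → ℂ := fun p => f p.1 (p.2.1 ^ 2 + p.2.2 ^ 2)
  have hg : (fun k : CffE => f (k 0) (k 1 ^ 2 + k 2 ^ 2)) = fun k => g (e k) := by
    funext k; simp [g, hk]
  rw [hg] at hf ⊢
  rw [he.integral_comp e.measurableEmbedding]
  have hgi : Integrable g := (he.integrable_comp_emb e.measurableEmbedding).1 hf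
  rw [Measure.volume_eq_prod] at hgi ⊢
  rw [integral_prod _ hgi]
  refine integral_congr_ae (ae_of_all _ fun x => ?_)
  exact cff_polar (f x)

lemma cff_norm_sq (k : CffE) : ‖k‖ ^ 2 = k 0 ^ 2 + (k 1 ^ 2 + k 2 ^ 2) := by
  rw [EuclideanSpace.norm_sq_eq, Fin.sum_univ_three]
  simp [add_assoc]

lemma cff_ball (β R : ℝ) (hR : 0 < R) (G : ℝ → ℝ → ℝ) (H : ℝ → ℝ)
    (hInt : IntegrableOn (fun k : CffE => ((G (k 0) (‖k‖ ^ 2) : ℝ) : ℂ) *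
      Complex.exp (Complex.I * ((β * k 0 : ℝ) : ℂ))) (Metric.closedBall 0 R))
    (hH : ∀ x, x ≠ 0 → x ^ 2 < R ^ 2 →
      ∫ r in (0:ℝ)..(√(R ^ 2 - x ^ 2)), r * G x (x ^ 2 + r ^ 2) = H x) :
    ∫ k in Metric.closedBall (0 : CffE) R, ((G (k 0) (‖k‖ ^ 2) : ℝ) : ℂ) *
      Complex.exp (Complex.I * ((β * k 0 : ℝ) : ℂ))
    = 2 * π * ∫ x in (-R)..R, ((H x : ℝ) : ℂ) * Complex.exp (Complex.I * ((β * x : ℝ) : ℂ)) := by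
  classical
  let f : ℝ → ℝ → ℂ := fun x s => if x ^ 2 + s ≤ R ^ 2 then ((G x (x ^ 2 + s) : ℝ) : ℂ) *
      Complex.exp (Complex.I * ((β * x : ℝ) : ℂ)) else 0
  have hfe : (Metric.closedBall (0 : CffE) R).indicator (fun k : CffE => ((G (k 0) (‖k‖ ^ 2) : ℝ) : ℂ) *
      Complex.exp (Complex.I * ((β * k 0 : ℝ) : ℂ))) = fun k => f (k 0) (k 1 ^ 2 + k 2 ^ 2) := by
    funext k
    have : k ∈ Metric.closedBall (0 : CffE) R ↔ k 0 ^ 2 + (k 1 ^ 2 + k 2 ^ 2) ≤ R ^ 2 := by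
      rw [mem_closedBall_zero_iff, ← cff_norm_sq, pow_le_pow_iff_left₀ (norm_nonneg _) hR.le two_ne_zero]
    simp only [Set.indicator, this, f, cff_norm_sq]
  rw [← integrable_indicator_iff measurableSet_closedBall, hfe] at hInt
  rw [← integral_indicator measurableSet_closedBall, hfe, cff_cyl f hInt, integral_const_mul]
  congr 1
  rw [intervalIntegral.integral_of_le (by linarith), ← integral_indicator measurableSet_Ioc]
  have hne : ∀ᵐ x : ℝ, x ≠ 0 ∧ x ≠ R := by
    have h1 : ∀ᵐ x : ℝ, x ≠ 0 := Measure.ae_ne volume 0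
    have h2 : ∀ᵐ x : ℝ, x ≠ R := Measure.ae_ne volume R
    filter_upwards [h1, h2] with x h h' using ⟨h, h'⟩
  refine integral_congr_ae ?_
  filter_upwards [hne] with x hx
  by_cases hxm : x ∈ Set.Ioc (-R) R
  · rw [Set.indicator_of_mem hxm]
    have hx2 : x ^ 2 < R ^ 2 := by
      apply sq_lt_sq'
      · exact hxm.1
      · exact lt_of_le_of_ne hxm.2 hx.2
    rw [← hH x hx.1 hx2, ← intervalIntegral.integral_ofReal, ← intervalIntegral.integral_mul_const,
      intervalIntegral.integral_of_le (Real.sqrt_nonneg _), ← integral_indicator measurableSet_Ioi,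
      ← integral_indicator measurableSet_Ioc]
    congr 1
    funext r
    have hiff : x ^ 2 + r ^ 2 ≤ R ^ 2 ↔ |r| ≤ √(R ^ 2 - x ^ 2) := by
      rw [Real.le_sqrt (abs_nonneg _) , sq_abs]
      · constructor <;> intro <;> linarith
      · linarith
    by_cases hr : 0 < r
    · rw [abs_of_pos hr] at hiff
      simp only [Set.indicator, Set.mem_Ioi, Set.mem_Ioc, hr, true_and, if_true, f, hiff]
      split_ifs
      · push_cast; ring
      · simp
    · simp [Set.indicator, hr]
  · rw [Set.indicator_of_notMem hxm]
    have hx2 : R ^ 2 < x ^ 2 ∨ x = -R := by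
      rw [Set.mem_Ioc, not_and_or, not_lt, not_le] at hxm
      rcases hxm with h | h
      · rcases eq_or_lt_of_le h with h | h
        · exact Or.inr h
        · left; nlinarith
      · left; nlinarith
    rw [setIntegral_congr_fun (g := fun _ => (0:ℂ)) measurableSet_Ioi, integral_zero]
    intro r hr
    have hr' : 0 < r := hr
    simp only [f]
    rw [if_neg, mul_zero]
    rcases hx2 with h | h
    · nlinarith [sq_nonneg r]
    · subst h; simp; positivity

lemma cff_H1 (R x : ℝ) (hR : 0 < R) (hx : x ≠ 0) (hxR : x ^ 2 < R ^ 2) :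
    ∫ r in (0:ℝ)..(√(R ^ 2 - x ^ 2)), r * (x ^ 2 + r ^ 2)⁻¹ = Real.log R - Real.log x := by
  have hp : ∀ r : ℝ, x ^ 2 + r ^ 2 ≠ 0 := fun r => by positivity
  rw [intervalIntegral.integral_eq_sub_of_hasDerivAt
    (f := fun r => (1 / 2) * Real.log (x ^ 2 + r ^ 2))]
  · rw [Real.sq_sqrt (by linarith)]
    simp
  · intro r _
    refine ((((hasDerivAt_pow 2 r).const_add (x ^ 2)).log (hp r)).const_mul (1 / 2)).congr_deriv ?_
    have := hp r
    field_simp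
    simp
  · apply Continuous.intervalIntegrable
    exact continuous_id.mul (Continuous.inv₀ (by fun_prop) hp)

lemma cff_H2 (R x : ℝ) (hR : 0 < R) (hx : x ≠ 0) (hxR : x ^ 2 < R ^ 2) :
    ∫ r in (0:ℝ)..(√(R ^ 2 - x ^ 2)), r * (x ^ 2 / (x ^ 2 + r ^ 2) ^ 2)
      = (1 / 2) * (1 - x ^ 2 / R ^ 2) := by
  have hp : ∀ r : ℝ, x ^ 2 + r ^ 2 ≠ 0 := fun r => by positivity
  rw [intervalIntegral.integral_eq_sub_of_hasDerivAt
    (f := fun r => -(x ^ 2 / 2) * (x ^ 2 + r ^ 2)⁻¹)]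
  · rw [Real.sq_sqrt (by linarith)]
    simp
    field_simp
    ring
  · intro r _
    refine ((((hasDerivAt_pow 2 r).const_add (x ^ 2)).inv (hp r)).const_mul (-(x ^ 2 / 2))).congr_deriv ?_
    have := hp r
    field_simp
    simp
  · apply Continuous.intervalIntegrable
    refine continuous_id.mul (Continuous.div (by fun_prop) (by fun_prop) ?_)
    intro r; have := hp r; positivity

lemma cff_intble_norm (R : ℝ) :
    IntegrableOn (fun k : CffE => (‖k‖ ^ 2)⁻¹) (Metric.closedBall 0 R) := by
  refine IntegrableOn.mono_set (t := Metric.ball 0 (R + 1)) ?_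
    (Metric.closedBall_subset_ball (by linarith))
  refine (integrableOn_fun_norm_addHaar (volume : Measure CffE) (f := fun r : ℝ => (r ^ 2)⁻¹)).2 ?_
  have : IntegrableOn (fun _ : ℝ => (1:ℝ)) (Set.Ioo 0 (R + 1)) := by simp
  refine this.congr_fun ?_ measurableSet_Ioo
  intro y hy
  have := hy.1.ne'
  simp [this]

lemma cff_abs_le (k : CffE) (m : Fin 3) : |k m| ≤ ‖k‖ := by
  simpa using PiLp.norm_apply_le k m

lemma cff_intble (R : ℝ) (m n : Fin 3) (φ : CffE → ℝ) (hφ : Continuous φ) :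
    IntegrableOn (fun k : CffE => ((k m * k n / ‖k‖ ^ 4 : ℝ) : ℂ) *
      Complex.exp (Complex.I * ((φ k : ℝ) : ℂ))) (Metric.closedBall 0 R) := by
  refine Integrable.mono' (cff_intble_norm R) ?_ ?_
  · apply Measurable.aestronglyMeasurable
    have := hφ.measurable
    fun_prop
  · refine ae_of_all _ fun k => ?_
    rw [norm_mul, mul_comm Complex.I, Complex.norm_exp_ofReal_mul_I, mul_one, Complex.norm_real,
      Real.norm_eq_abs, abs_div, abs_mul, abs_of_nonneg (a := ‖k‖ ^ 4) (by positivity)]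
    rcases eq_or_ne k 0 with rfl | hk
    · simp
    · have : 0 < ‖k‖ := norm_pos_iff.2 hk
      rw [div_le_iff₀ (by positivity)]
      have h1 : (‖k‖ ^ 2)⁻¹ * ‖k‖ ^ 4 = ‖k‖ * ‖k‖ := by field_simp
      rw [h1]
      exact mul_le_mul (cff_abs_le k m) (cff_abs_le k n) (abs_nonneg _) (norm_nonneg _)

noncomputable def cffI (β R : ℝ) (m n : Fin 3) : ℂ :=
  ∫ k in Metric.closedBall (0 : CffE) R, ((k m * k n / ‖k‖ ^ 4 : ℝ) : ℂ) *
      Complex.exp (Complex.I * ((β * k 0 : ℝ) : ℂ))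

lemma cff_subst (R : ℝ) (L : CffE ≃ₗᵢ[ℝ] CffE) (g : CffE → ℂ) :
    ∫ k in Metric.closedBall (0 : CffE) R, g k = ∫ k in Metric.closedBall (0 : CffE) R, g (L k) := by
  have h := L.measurePreserving.setIntegral_preimage_emb L.toHomeomorph.measurableEmbedding g
    (Metric.closedBall 0 R)
  rw [← h]
  congr 2
  ext k; simp

lemma cffI_off (β R : ℝ) (m n : Fin 3) (hmn : m ≠ n) (hm : m ≠ 0) : cffI β R m n = 0 := by
  let L : CffE ≃ₗᵢ[ℝ] CffE := LinearIsometryEquiv.piLpCongrRight 2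
    (fun l : Fin 3 => if l = m then LinearIsometryEquiv.neg ℝ else LinearIsometryEquiv.refl ℝ ℝ)
  have hLm : ∀ k, L k m = - k m := fun k => by simp [L]
  have hL : ∀ k l, l ≠ m → L k l = k l := fun k l hl => by simp [L, hl]
  have h := cff_subst R L (fun k => ((k m * k n / ‖k‖ ^ 4 : ℝ) : ℂ) *
      Complex.exp (Complex.I * ((β * k 0 : ℝ) : ℂ)))
  simp only [hLm, hL _ n hmn.symm, hL _ 0 hm.symm, LinearIsometryEquiv.norm_map] at h
  simp only [neg_mul, neg_div, Complex.ofReal_neg, integral_neg] at h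
  unfold cffI
  simpa [self_eq_neg] using h

lemma cffI_comm (β R : ℝ) (m n : Fin 3) : cffI β R m n = cffI β R n m := by
  unfold cffI; simp_rw [mul_comm]

lemma cffI_12 (β R : ℝ) : cffI β R 1 1 = cffI β R 2 2 := by
  let L : CffE ≃ₗᵢ[ℝ] CffE := LinearIsometryEquiv.piLpCongrLeft 2 ℝ ℝ (Equiv.swap (1 : Fin 3) 2)
  have h := cff_subst R L (fun k => ((k 1 * k 1 / ‖k‖ ^ 4 : ℝ) : ℂ) *
      Complex.exp (Complex.I * ((β * k 0 : ℝ) : ℂ)))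
  have h1 : ∀ k, L k 1 = k 2 := fun k => by
    simp [L, LinearIsometryEquiv.piLpCongrLeft_apply, Equiv.piCongrLeft']
  have h0 : ∀ k, L k 0 = k 0 := fun k => by
    simp [L, LinearIsometryEquiv.piLpCongrLeft_apply, Equiv.piCongrLeft']; rfl
  simp only [h1, h0, LinearIsometryEquiv.norm_map] at h
  exact h

lemma cffI_00_lim (β : ℝ) (hβ : 0 < β) :
    Tendsto (fun R => cffI β R 0 0) atTop (nhds 0) := by
  have key : Tendsto (fun R : ℝ => 2 * π * (-2 * Real.cos (β * R) / (β ^ 2 * R)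
      + 2 * Real.sin (β * R) / (β ^ 3 * R ^ 2))) atTop (nhds 0) := by
    have hb : Tendsto (fun R : ℝ => 2 * π * (2 / β ^ 2 * R⁻¹ + 2 / β ^ 3 * (R⁻¹) ^ 2)) atTop (nhds 0) := by
      have h := tendsto_inv_atTop_zero (𝕜 := ℝ)
      simpa using ((h.const_mul (2 / β ^ 2)).add ((h.pow 2).const_mul (2 / β ^ 3))).const_mul (2 * π)
    refine squeeze_zero_norm' ?_ hb
    filter_upwards [eventually_gt_atTop 0] with R hR
    rw [Real.norm_eq_abs, abs_mul, abs_of_pos (a := 2 * π) (by positivity)]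
    gcongr
    refine (abs_add_le _ _).trans (add_le_add ?_ ?_)
    · rw [abs_div, abs_mul, abs_of_pos (a := β ^ 2 * R) (by positivity), div_le_iff₀ (by positivity)]
      have : 2 / β ^ 2 * R⁻¹ * (β ^ 2 * R) = 2 := by field_simp
      rw [this]
      have := Real.abs_cos_le_one (β * R)
      norm_num; linarith
    · rw [abs_div, abs_mul, abs_of_pos (a := β ^ 3 * R ^ 2) (by positivity), div_le_iff₀ (by positivity)]
      have : 2 / β ^ 3 * R⁻¹ ^ 2 * (β ^ 3 * R ^ 2) = 2 := by field_simp
      rw [this]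
      have := Real.abs_sin_le_one (β * R)
      norm_num; linarith
  have key' := (Complex.continuous_ofReal.tendsto 0).comp key
  rw [Complex.ofReal_zero] at key'
  refine key'.congr' ?_
  filter_upwards [eventually_gt_atTop 0] with R hR
  have hG : ∀ k : CffE, k 0 * k 0 / ‖k‖ ^ 4 = (fun x s : ℝ => x ^ 2 / s ^ 2) (k 0) (‖k‖ ^ 2) := by
    intro k; simp only; rw [← pow_mul]; ring_nf
  have hInt := cff_intble R 0 0 (fun k => β * k 0) (by fun_prop)
  unfold cffI
  simp_rw [hG] at hInt ⊢
  rw [cff_ball β R hR (fun x s : ℝ => x ^ 2 / s ^ 2) (fun x => (1 / 2) * (1 - x ^ 2 / R ^ 2)) hInt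
    (fun x hx hxR => cff_H2 R x hR hx hxR), cff_even β R _ (by simp) (by
      apply Continuous.intervalIntegrable; fun_prop) hR]
  have : ∀ x : ℝ, Real.cos (β * x) * ((1 / 2) * (1 - x ^ 2 / R ^ 2))
    = (1 / 2) * (Real.cos (β * x) * (1 - x ^ 2 / R ^ 2)) := fun x => by ring
  simp_rw [this]
  rw [intervalIntegral.integral_const_mul, cff_par β R hβ hR]
  simp only [Function.comp]
  push_cast
  ring

lemma cffI_trace_lim (β : ℝ) (hβ : 0 < β) :
    Tendsto (fun R => cffI β R 0 0 + cffI β R 1 1 + cffI β R 2 2) atTop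
      (nhds ((2 * π ^ 2 / β : ℝ) : ℂ)) := by
  have key : Tendsto (fun R : ℝ => 2 * π * (2 * (β⁻¹ * ∫ x in (0:ℝ)..(β * R), Real.sinc x))) atTop
      (nhds (2 * π ^ 2 / β)) := by
    have h := cff_dirichlet.comp (tendsto_id.const_mul_atTop hβ)
    have h' := ((h.const_mul β⁻¹).const_mul 2).const_mul (2 * π)
    have e : 2 * π * (2 * (β⁻¹ * (π / 2))) = 2 * π ^ 2 / β := by field_simp
    rw [e] at h'
    exact h'
  have key' := (Complex.continuous_ofReal.tendsto _).comp key
  refine key'.congr' ?_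
  filter_upwards [eventually_gt_atTop 0] with R hR
  have hi : ∀ m, IntegrableOn (fun k : CffE => ((k m * k m / ‖k‖ ^ 4 : ℝ) : ℂ) *
      Complex.exp (Complex.I * ((β * k 0 : ℝ) : ℂ))) (Metric.closedBall 0 R) :=
    fun m => cff_intble R m m (fun k => β * k 0) (by fun_prop)
  unfold cffI
  rw [← integral_add (hi 0) (hi 1), ← integral_add (by exact (hi 0).add (hi 1)) (hi 2)]
  have hInt := ((hi 0).add (hi 1)).add (hi 2)
  have hG : ∀ k : CffE, ((k 0 * k 0 / ‖k‖ ^ 4 : ℝ) : ℂ) *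
      Complex.exp (Complex.I * ((β * k 0 : ℝ) : ℂ)) + ((k 1 * k 1 / ‖k‖ ^ 4 : ℝ) : ℂ) *
      Complex.exp (Complex.I * ((β * k 0 : ℝ) : ℂ)) + ((k 2 * k 2 / ‖k‖ ^ 4 : ℝ) : ℂ) *
      Complex.exp (Complex.I * ((β * k 0 : ℝ) : ℂ))
      = (((fun _ s : ℝ => s⁻¹) (k 0) (‖k‖ ^ 2) : ℝ) : ℂ) *
        Complex.exp (Complex.I * ((β * k 0 : ℝ) : ℂ)) := by
    intro k
    rw [← add_mul, ← add_mul, ← Complex.ofReal_add, ← Complex.ofReal_add]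
    congr 2
    have h := cff_norm_sq k
    have h4 : k 0 * k 0 / ‖k‖ ^ 4 + k 1 * k 1 / ‖k‖ ^ 4 + k 2 * k 2 / ‖k‖ ^ 4
      = ‖k‖ ^ 2 / ‖k‖ ^ 4 := by rw [h]; ring
    rw [h4]
    rcases eq_or_ne ‖k‖ 0 with h0 | h0
    · simp [h0]
    · simp only; field_simp
  have hInt' : IntegrableOn (fun k : CffE => (((fun _ s : ℝ => s⁻¹) (k 0) (‖k‖ ^ 2) : ℝ) : ℂ) *
        Complex.exp (Complex.I * ((β * k 0 : ℝ) : ℂ))) (Metric.closedBall 0 R) :=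
    Integrable.congr hInt (ae_of_all _ hG)
  rw [integral_congr_ae (ae_of_all _ hG), cff_ball β R hR (fun _ s : ℝ => s⁻¹) (fun x => Real.log R - Real.log x) hInt'
    (fun x hx hxR => cff_H1 R x hR hx hxR), cff_even β R _ (by simp)
    (intervalIntegrable_const.sub intervalIntegral.intervalIntegrable_log') hR, cff_log β R hβ hR]
  simp only [Function.comp]
  push_cast
  ring

lemma cffI_lim (β : ℝ) (hβ : 0 < β) (m n : Fin 3) :
    Tendsto (fun R => cffI β R m n) atTop
      (nhds ((π ^ 2 / β * ((if m = n then (1:ℝ) else 0) - (if m = 0 then (1:ℝ) else 0) *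
        (if n = 0 then (1:ℝ) else 0)) : ℝ) : ℂ)) := by
  have h1 : Tendsto (fun R => cffI β R 1 1) atTop (nhds ((π ^ 2 / β : ℝ) : ℂ)) := by
    have h := ((cffI_trace_lim β hβ).sub (cffI_00_lim β hβ)).const_mul (1 / 2)
    have e : (1 / 2 : ℂ) * (((2 * π ^ 2 / β : ℝ) : ℂ) - 0) = ((π ^ 2 / β : ℝ) : ℂ) := by
      push_cast; ring
    rw [e] at h
    refine h.congr fun R => ?_
    rw [← cffI_12]; ring
  by_cases hmn : m = n
  · subst hmn
    fin_cases m
    · simpa using cffI_00_lim β hβ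
    · simpa using h1
    · simpa [cffI_12] using h1
  · have hz : ∀ R, cffI β R m n = 0 := by
      intro R
      by_cases hm : m = 0
      · rw [cffI_comm]
        exact cffI_off β R n m (Ne.symm hmn) (by rintro rfl; exact hmn hm)
      · exact cffI_off β R m n hmn hm
    simp only [hz]
    have : (if m = 0 then (1:ℝ) else 0) * (if n = 0 then (1:ℝ) else 0) = 0 := by
      by_cases hm : m = 0
      · have : n ≠ 0 := by rintro rfl; exact hmn hm
        simp [this]
      · simp [hm]
    rw [this]
    simp [hmn]

/-- Oscillatory Fourier integral of the Coulomb force kernel: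
`lim_{R→∞} ∫_{|k|≤R} (kᵢkⱼ/|k|⁴) e^{i⟨k,b⟩} dk = (π²/|b|)(δᵢⱼ − bᵢbⱼ/|b|²)`. -/
theorem coulomb_force_fourier_integral
    (b : EuclideanSpace ℝ (Fin 3)) (hb : b ≠ 0) (i j : Fin 3) :
    Tendsto (fun R : ℝ =>
        ∫ k in Metric.closedBall (0 : EuclideanSpace ℝ (Fin 3)) R,
          ((k i * k j / ‖k‖ ^ 4 : ℝ) : ℂ)
            * Complex.exp (Complex.I * ((⟪k, b⟫ : ℝ) : ℂ)))
      atTop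
      (nhds ((((π ^ 2 / ‖b‖)
          * ((if i = j then (1:ℝ) else 0) - b i * b j / ‖b‖ ^ 2) : ℝ) : ℂ))) := by
  have hβ : 0 < ‖b‖ := norm_pos_iff.2 hb
  have hon : Orthonormal ℝ (({0} : Set (Fin 3)).domRestrict (fun _ : Fin 3 => (‖b‖⁻¹ • b : CffE))) := by
    constructor
    · intro x
      change ‖(‖b‖⁻¹ • b : CffE)‖ = 1
      rw [norm_smul, norm_inv, norm_norm, inv_mul_cancel₀ hβ.ne']
    · intro x y hxy; exact absurd (Subsingleton.elim x y) hxy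
  obtain ⟨v, hv⟩ := hon.exists_orthonormalBasis_extension_of_card_eq (by simp)
  have hv0 : v 0 = ‖b‖⁻¹ • b := hv 0 rfl
  let L : CffE ≃ₗᵢ[ℝ] CffE := v.repr.symm
  have hL : ∀ k l, L k l = ∑ m, k m * v m l := by
    intro k l
    have : L k = ∑ m, k m • v m := (v.sum_repr_symm k).symm
    rw [this]; simp
  have hLb : ∀ k, ⟪L k, b⟫ = ‖b‖ * k 0 := by
    intro k
    have h1 : b = ‖b‖ • v 0 := by rw [hv0, smul_smul, mul_inv_cancel₀ hβ.ne', one_smul]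
    have h2 : ⟪L k, v 0⟫ = k 0 := by
      rw [real_inner_comm, ← v.repr_apply_apply]; simp [L]
    conv_lhs => rw [h1]
    rw [real_inner_smul_right, h2]
  have hcomp : ∑ m, v m i * v m j = if i = j then (1:ℝ) else 0 := by
    have h := v.sum_inner_mul_inner (EuclideanSpace.single i (1:ℝ)) (EuclideanSpace.single j (1:ℝ))
    simp only [EuclideanSpace.inner_single_left, EuclideanSpace.inner_single_right] at h
    simp at h
    rw [h]
    simp [eq_comm, Pi.single_apply]
  have hsum : ∀ R, (∫ k in Metric.closedBall (0 : EuclideanSpace ℝ (Fin 3)) R,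
          ((k i * k j / ‖k‖ ^ 4 : ℝ) : ℂ)
            * Complex.exp (Complex.I * ((⟪k, b⟫ : ℝ) : ℂ)))
      = ∑ m, ∑ n, ((v m i * v n j : ℝ) : ℂ) * cffI ‖b‖ R m n := by
    intro R
    rw [cff_subst R L]
    unfold cffI
    have hi : ∀ m n, IntegrableOn (fun k : CffE => ((v m i * v n j : ℝ) : ℂ) *
        (((k m * k n / ‖k‖ ^ 4 : ℝ) : ℂ) *
        Complex.exp (Complex.I * ((‖b‖ * k 0 : ℝ) : ℂ)))) (Metric.closedBall 0 R) :=
      fun m n => (cff_intble R m n (fun k => ‖b‖ * k 0) (by fun_prop)).const_mul _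
    simp_rw [← integral_const_mul]
    simp_rw [← integral_finsetSum _ (fun n _ => hi _ n)]
    rw [← integral_finsetSum _ (fun m _ => integrable_finsetSum _ (fun n _ => hi m n))]
    refine integral_congr_ae (ae_of_all _ fun k => ?_)
    simp only [hLb, hL, LinearIsometryEquiv.norm_map, Fin.sum_univ_three]
    push_cast
    ring
  simp_rw [hsum]
  have hlim := tendsto_finsetSum Finset.univ (fun m _ => tendsto_finsetSum Finset.univ
    (fun n _ => (cffI_lim ‖b‖ hβ m n).const_mul ((v m i * v n j : ℝ) : ℂ)))
  convert hlim using 2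
  rw [← hcomp]
  have e : ∀ l, v 0 l = ‖b‖⁻¹ * b l := fun l => by rw [hv0]; simp
  have e2 : b i * b j / ‖b‖ ^ 2 = v 0 i * v 0 j := by rw [e, e]; field_simp
  rw [e2]
  simp only [← Complex.ofReal_mul, ← Complex.ofReal_sum]
  congr 1
  simp [Fin.sum_univ_three]
  ring
end
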